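/- Let g : S × S → Bool be any function assigning to each encoder transition one of its output bits (so that the coded bit at time t is z_t = g(S_{t−1}, S_t)). Then the serial and parallel a-posteriori probabilities of the coded bits coincide: for every t ∈ {1,…,L} and every observation sequence y with P(Y = y) > 0, one has P(g(S_{t−1}, S_t) = 0 | Y = y) = P(g(S_{t−1}, S_t) = 0 | Y_{i(t)} = y|_{i(t)}). -/

import Mathlib

/-!
Finite hidden Markov source over a memoryless channel.
States `S` (with distinguished state `0`), channel output symbols `O`.
A state path is `s : Fin (L+1) → S`; an observation sequence is `y : Fin L → O`,
where index `t : Fin L` represents time `t+1 ∈ {1,…,L}`.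
-/

open scoped Classical in
/-- The probability of an event `A` under the mass function `P`. -/
noncomputable def prob {S O : Type*} [Fintype S] [Fintype O] {L : ℕ}
    (P : (Fin (L + 1) → S) × (Fin L → O) → ℝ)
    (A : (Fin (L + 1) → S) × (Fin L → O) → Prop) : ℝ :=
  ∑ sy : (Fin (L + 1) → S) × (Fin L → O), if A sy then P sy else 0

/-- The conditional probability `P(A | B)`. -/
noncomputable def condProb {S O : Type*} [Fintype S] [Fintype O] {L : ℕ}
    (P : (Fin (L + 1) → S) × (Fin L → O) → ℝ)
    (A B : (Fin (L + 1) → S) × (Fin L → O) → Prop) : ℝ :=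
  prob P (fun sy => A sy ∧ B sy) / prob P B

/-- Follow `x'` on the time window from `a` to `b` (states at times `a, …, b`, observations at times
`a + 1, …, b`) and `x` elsewhere. -/
def splice {S O : Type*} {L : ℕ} (a b : ℕ) (x x' : (Fin (L + 1) → S) × (Fin L → O)) :
    (Fin (L + 1) → S) × (Fin L → O) :=
  (fun j => if a ≤ (j : ℕ) ∧ (j : ℕ) ≤ b then x'.1 j else x.1 j,
    fun k => if a < (k : ℕ) + 1 ∧ (k : ℕ) + 1 ≤ b then x'.2 k else x.2 k)

theorem splice_fst_of_mem {S O : Type*} {L a b : ℕ} (x x' : (Fin (L + 1) → S) × (Fin L → O))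
    {j : Fin (L + 1)} (hj : a ≤ (j : ℕ) ∧ (j : ℕ) ≤ b) : (splice a b x x').1 j = x'.1 j :=
  if_pos hj

theorem splice_snd_of_mem {S O : Type*} {L a b : ℕ} (x x' : (Fin (L + 1) → S) × (Fin L → O))
    {k : Fin L} (hk : a < (k : ℕ) + 1 ∧ (k : ℕ) + 1 ≤ b) : (splice a b x x').2 k = x'.2 k :=
  if_pos hk

theorem splice_snd_of_notMem {S O : Type*} {L a b : ℕ} (x x' : (Fin (L + 1) → S) × (Fin L → O))
    {k : Fin L} (hk : ¬(a < (k : ℕ) + 1 ∧ (k : ℕ) + 1 ≤ b)) : (splice a b x x').2 k = x.2 k :=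
  if_neg hk

theorem splice_splice {S O : Type*} {L : ℕ} (a b : ℕ) (x x' : (Fin (L + 1) → S) × (Fin L → O)) :
    splice a b (splice a b x x') (splice a b x' x) = x := by
  ext j <;> simp only [splice] <;> split_ifs <;> rfl

/-- Exchanging the window from `a` to `b` between two trajectories, as a permutation. -/
def spliceEquiv (S O : Type*) {L : ℕ} (a b : ℕ) :
    Equiv.Perm (((Fin (L + 1) → S) × (Fin L → O)) × ((Fin (L + 1) → S) × (Fin L → O))) where
  toFun w := (splice a b w.1 w.2, splice a b w.2 w.1)
  invFun w := (splice a b w.1 w.2, splice a b w.2 w.1)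
  left_inv w := Prod.ext (splice_splice a b w.1 w.2) (splice_splice a b w.2 w.1)
  right_inv w := Prod.ext (splice_splice a b w.1 w.2) (splice_splice a b w.2 w.1)

/-- A transition-local product is preserved by splicing two state paths that agree at both ends of
the window. -/
theorem splice_transition_mul {S O : Type*} {L : ℕ} (f : O → S → S → ℝ) {α β : Fin (L + 1)}
    {x x' : (Fin (L + 1) → S) × (Fin L → O)} (hα : x.1 α = x'.1 α) (hβ : x.1 β = x'.1 β)
    (t : Fin L) :
    f ((splice α β x x').2 t) ((splice α β x x').1 t.castSucc) ((splice α β x x').1 t.succ) *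
        f ((splice α β x' x).2 t) ((splice α β x' x).1 t.castSucc)
          ((splice α β x' x).1 t.succ) =
      f (x.2 t) (x.1 t.castSucc) (x.1 t.succ) * f (x'.2 t) (x'.1 t.castSucc) (x'.1 t.succ) := by
  by_cases ht : (α : ℕ) < (t : ℕ) + 1 ∧ (t : ℕ) + 1 ≤ (β : ℕ)
  · have h₁ : (α : ℕ) ≤ (t.castSucc : ℕ) ∧ (t.castSucc : ℕ) ≤ (β : ℕ) := by
      simp only [Fin.val_castSucc]; omega
    have h₂ : (α : ℕ) ≤ (t.succ : ℕ) ∧ (t.succ : ℕ) ≤ (β : ℕ) := by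
      simp only [Fin.val_succ]; omega
    simp only [splice_snd_of_mem _ _ ht, splice_fst_of_mem _ _ h₁, splice_fst_of_mem _ _ h₂]
    exact mul_comm _ _
  · have hcast : (α : ℕ) ≤ (t.castSucc : ℕ) ∧ (t.castSucc : ℕ) ≤ (β : ℕ) →
        x.1 t.castSucc = x'.1 t.castSucc := fun h => by
      have : t.castSucc = β := Fin.ext (by simp only [Fin.val_castSucc] at h ⊢; omega)
      rw [this, hβ]
    have hsucc : (α : ℕ) ≤ (t.succ : ℕ) ∧ (t.succ : ℕ) ≤ (β : ℕ) →
        x.1 t.succ = x'.1 t.succ := fun h => by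
      have : t.succ = α := Fin.ext (by simp only [Fin.val_succ] at h ⊢; omega)
      rw [this, hα]
    simp only [splice_snd_of_notMem _ _ ht]
    simp only [splice]
    split_ifs with h₁ h₂ h₂
    · rw [hcast h₁, hsucc h₂]
    · rw [hcast h₁]
    · rw [hsucc h₂]
    · rfl

/-- Two trajectories pinned to `0` at both ends of the window (whenever they have positive mass) may
exchange the window without changing the product of their masses. -/
theorem mass_mul_splice {S O : Type*} [Zero S] [DecidableEq S] {L : ℕ} (f : O → S → S → ℝ)
    (P : (Fin (L + 1) → S) × (Fin L → O) → ℝ)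
    (hP : ∀ s y, P (s, y) =
      (if s 0 = 0 then (1 : ℝ) else 0) * ∏ t : Fin L, f (y t) (s t.castSucc) (s t.succ))
    {α β : Fin (L + 1)} (hαβ : α ≤ β) (hα : ∀ x, P x ≠ 0 → x.1 α = 0)
    (hβ : ∀ x, P x ≠ 0 → x.1 β = 0) (x x' : (Fin (L + 1) → S) × (Fin L → O)) :
    P (splice α β x x') * P (splice α β x' x) = P x * P x' := by
  have hαmem : (α : ℕ) ≤ (α : ℕ) ∧ (α : ℕ) ≤ (β : ℕ) := ⟨le_rfl, hαβ⟩
  have hβmem : (α : ℕ) ≤ (β : ℕ) ∧ (β : ℕ) ≤ (β : ℕ) := ⟨hαβ, le_rfl⟩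
  by_cases h : (x.1 α = 0 ∧ x.1 β = 0) ∧ (x'.1 α = 0 ∧ x'.1 β = 0)
  · obtain ⟨⟨h₁, h₂⟩, h₃, h₄⟩ := h
    have hP' (z) : P z = (if z.1 0 = 0 then (1 : ℝ) else 0) *
        ∏ t : Fin L, f (z.2 t) (z.1 t.castSucc) (z.1 t.succ) := hP z.1 z.2
    have hinit : (if (splice α β x x').1 0 = 0 then (1 : ℝ) else 0) *
          (if (splice α β x' x).1 0 = 0 then (1 : ℝ) else 0) =
        (if x.1 0 = 0 then (1 : ℝ) else 0) * (if x'.1 0 = 0 then (1 : ℝ) else 0) := by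
      by_cases h0 : (α : ℕ) ≤ ((0 : Fin (L + 1)) : ℕ) ∧ ((0 : Fin (L + 1)) : ℕ) ≤ (β : ℕ)
      · simp only [splice, if_pos h0]
        exact mul_comm _ _
      · simp only [splice, if_neg h0]
    rw [hP', hP', hP' x, hP' x', mul_mul_mul_comm, hinit,
      ← Finset.prod_mul_distrib, mul_mul_mul_comm, ← Finset.prod_mul_distrib]
    congr 1
    exact Finset.prod_congr rfl fun t _ =>
      splice_transition_mul f (h₁.trans h₃.symm) (h₂.trans h₄.symm) t
  · have hzero : P x * P x' = 0 := by
      by_contra hne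
      exact h ⟨⟨hα _ (left_ne_zero_of_mul hne), hβ _ (left_ne_zero_of_mul hne)⟩,
        hα _ (right_ne_zero_of_mul hne), hβ _ (right_ne_zero_of_mul hne)⟩
    rw [hzero]
    by_contra hne
    have hl := left_ne_zero_of_mul hne
    have hr := right_ne_zero_of_mul hne
    have e₁ := hα _ hl
    have e₂ := hβ _ hl
    have e₃ := hα _ hr
    have e₄ := hβ _ hr
    rw [splice_fst_of_mem _ _ hαmem] at e₁ e₃
    rw [splice_fst_of_mem _ _ hβmem] at e₂ e₄
    exact h ⟨⟨e₃, e₄⟩, e₁, e₂⟩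

open scoped Classical in
theorem prob_mul_prob {S O : Type*} [Fintype S] [Fintype O] {L : ℕ}
    (P : (Fin (L + 1) → S) × (Fin L → O) → ℝ)
    (A B : (Fin (L + 1) → S) × (Fin L → O) → Prop) :
    prob P A * prob P B =
      ∑ w : ((Fin (L + 1) → S) × (Fin L → O)) × ((Fin (L + 1) → S) × (Fin L → O)),
        if A w.1 ∧ B w.2 then P w.1 * P w.2 else 0 := by
  simp_rw [prob, Fintype.sum_mul_sum, ite_zero_mul_ite_zero]
  exact (Fintype.sum_prod_type' _).symm

theorem prob_mono {S O : Type*} [Fintype S] [Fintype O] {L : ℕ}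
    {P : (Fin (L + 1) → S) × (Fin L → O) → ℝ} (hP : ∀ x, 0 ≤ P x)
    {A B : (Fin (L + 1) → S) × (Fin L → O) → Prop} (hAB : ∀ x, A x → B x) :
    prob P A ≤ prob P B := by
  refine Finset.sum_le_sum fun x _ => ?_
  split_ifs with hA hB hB
  · exact le_rfl
  · exact absurd (hAB x hA) hB
  · exact hP x
  · exact le_rfl

/-- **Serial and parallel a-posteriori probabilities of the coded bits coincide.**
`g : S → S → Bool` assigns to each encoder transition one of its output bits
(`false` playing the role of the bit 0), so the coded bit at time t+1 is
`g (s t.castSucc) (s t.succ)`. -/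
theorem serial_parallel_APP_coded_bits
    {S O : Type*} [Fintype S] [Fintype O] [Nonempty S] [Nonempty O]
    [Zero S] [DecidableEq S]
    {N L : ℕ} (hN : 1 ≤ N) (hL : 1 ≤ L)
    -- boundary times 0 = L_0 < L_1 < ⋯ < L_N = L
    (Lb : Fin (N + 1) → Fin (L + 1)) (hmono : StrictMono Lb)
    (hLb0 : Lb 0 = 0) (hLbN : Lb (Fin.last N) = Fin.last L)
    -- the factorizing probability mass function
    (p : S → S → ℝ) (q : O → S → S → ℝ)
    (hp : ∀ a b, 0 ≤ p a b) (hq : ∀ o a b, 0 ≤ q o a b)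
    (P : (Fin (L + 1) → S) × (Fin L → O) → ℝ)
    (hP : ∀ s y, P (s, y) =
      (if s 0 = 0 then (1 : ℝ) else 0) *
        ∏ t : Fin L, p (s t.castSucc) (s t.succ) * q (y t) (s t.castSucc) (s t.succ))
    (hsum : ∑ sy : (Fin (L + 1) → S) × (Fin L → O), P sy = 1)
    -- termination: each parallel codeword drives the encoder back to state 0
    (hterm : ∀ s y, P (s, y) ≠ 0 → ∀ i : Fin (N + 1), s (Lb i) = 0)
    -- the output-bit map
    (g : S → S → Bool)
    -- the observation sequence, with positive serial probability
    (y : Fin L → O)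
    (hy : 0 < prob P (fun sy => sy.2 = y))
    -- the time t (as an element of Fin L, representing time t+1) and its segment index
    (t : Fin L) (i : Fin N)
    (hti : ((Lb i.castSucc : ℕ) < (t : ℕ) + 1) ∧ ((t : ℕ) + 1 ≤ (Lb i.succ : ℕ))) :
    condProb P (fun sy => g (sy.1 t.castSucc) (sy.1 t.succ) = false) (fun sy => sy.2 = y) =
      condProb P (fun sy => g (sy.1 t.castSucc) (sy.1 t.succ) = false)
        (fun sy => ∀ k : Fin L,
          (Lb i.castSucc : ℕ) < (k : ℕ) + 1 → (k : ℕ) + 1 ≤ (Lb i.succ : ℕ) →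
            sy.2 k = y k) := by
  classical
  have hαβ : Lb i.castSucc ≤ Lb i.succ := (hmono Fin.castSucc_lt_succ).le
  have hnonneg (x) : 0 ≤ P x := by
    rw [show P x = P (x.1, x.2) from rfl, hP]
    refine mul_nonneg (by split_ifs <;> norm_num) (Finset.prod_nonneg fun k _ => ?_)
    exact mul_nonneg (hp _ _) (hq _ _ _)
  have hpar : 0 < prob P (fun sy => ∀ k : Fin L, (Lb i.castSucc : ℕ) < (k : ℕ) + 1 →
      (k : ℕ) + 1 ≤ (Lb i.succ : ℕ) → sy.2 k = y k) :=
    hy.trans_le (prob_mono hnonneg fun _ hx k _ _ => congrFun hx k)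
  have hmass := mass_mul_splice (fun o a b => p a b * q o a b) P hP hαβ
    (fun x hx => hterm x.1 x.2 hx _) (fun x hx => hterm x.1 x.2 hx _)
  rw [condProb, condProb, div_eq_div_iff hy.ne' hpar.ne',
    mul_comm (prob P (fun sy => _ ∧ ∀ k, _)), prob_mul_prob, prob_mul_prob]
  refine Fintype.sum_equiv (spliceEquiv S O (Lb i.castSucc) (Lb i.succ)) _ _ fun w => ?_
  obtain ⟨x, x'⟩ := w
  simp only [spliceEquiv, Equiv.coe_fn_mk, hmass]
  refine if_congr ?_ rfl rfl
  have hcast : (Lb i.castSucc : ℕ) ≤ (t.castSucc : ℕ) ∧ (t.castSucc : ℕ) ≤ (Lb i.succ : ℕ) := by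
    simp only [Fin.val_castSucc]; omega
  have hsucc : (Lb i.castSucc : ℕ) ≤ (t.succ : ℕ) ∧ (t.succ : ℕ) ≤ (Lb i.succ : ℕ) := by
    simp only [Fin.val_succ]; omega
  rw [splice_fst_of_mem _ _ hcast, splice_fst_of_mem _ _ hsucc]
  constructor
  · rintro ⟨⟨hg, hx⟩, hx'⟩
    refine ⟨funext fun k => ?_, hg, fun k h₁ h₂ => ?_⟩
    · by_cases hk : (Lb i.castSucc : ℕ) < (k : ℕ) + 1 ∧ (k : ℕ) + 1 ≤ (Lb i.succ : ℕ)
      · rw [splice_snd_of_mem _ _ hk, hx' k hk.1 hk.2]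
      · rw [splice_snd_of_notMem _ _ hk, hx]
    · rw [splice_snd_of_mem _ _ ⟨h₁, h₂⟩, hx]
  · rintro ⟨hz, hg, hz'⟩
    refine ⟨⟨hg, funext fun k => ?_⟩, fun k h₁ h₂ => ?_⟩
    · by_cases hk : (Lb i.castSucc : ℕ) < (k : ℕ) + 1 ∧ (k : ℕ) + 1 ≤ (Lb i.succ : ℕ)
      · rw [← splice_snd_of_mem x' x hk, hz' k hk.1 hk.2]
      · rw [← splice_snd_of_notMem x x' hk, hz]
    · rw [← splice_snd_of_mem x x' ⟨h₁, h₂⟩, hz]
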